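/- The Thue equation x^5 + 65·x^4·y − 870·x^3·y^2 − 18990·x^2·y^3 + 26325·x·y^4 + 255069·y^5 = −2^5·3^4·11^2 has no integer solutions (x, y). -/

import Mathlib

open NumberField NumberField.Units Module Polynomial

/-- The defining polynomial of the quintic field, Eisenstein at `5`. -/
noncomputable def quintic : ℤ[X] :=
  X ^ 5 - 5 * X ^ 4 - 10 * X ^ 3 + 50 * X ^ 2 + 25 * X - 15

theorem quintic_eq : quintic =
    X ^ 5 + C (-5) * X ^ 4 + C (-10) * X ^ 3 + C 50 * X ^ 2 + C 25 * X + C (-15) := by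
  simp [quintic, sub_eq_add_neg]

theorem natDegree_quintic : quintic.natDegree = 5 := by
  rw [quintic_eq]; compute_degree!

theorem monic_quintic : quintic.Monic := by
  rw [quintic_eq]; monicity!

theorem isEisensteinAt_quintic : quintic.IsEisensteinAt (Ideal.span {5}) where
  leading := by
    rw [monic_quintic.leadingCoeff, Ideal.mem_span_singleton]; decide
  mem := by
    intro n hn
    rw [natDegree_quintic] at hn
    rw [Ideal.mem_span_singleton, quintic_eq]
    interval_cases n <;> simp [coeff_X, coeff_X_pow]
  notMem := by
    rw [Ideal.span_singleton_pow, Ideal.mem_span_singleton, quintic_eq]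
    simp [coeff_X, coeff_X_pow]

theorem prime_five_int : Prime (5 : ℤ) := Int.prime_iff_natAbs_prime.2 (by norm_num)

theorem irreducible_quintic : Irreducible quintic :=
  isEisensteinAt_quintic.irreducible
    ((Ideal.span_singleton_prime (by decide)).2 prime_five_int) monic_quintic.isPrimitive
    (by rw [natDegree_quintic]; decide)

theorem minpoly_int_eq_of_irreducible {S : Type*} [CommRing S] [IsDomain S] [CharZero S] {a : S}
    {q : ℤ[X]} (hq : Irreducible q) (hm : q.Monic) (h : aeval a q = 0) : minpoly ℤ a = q := by
  have hintegral : IsIntegral ℤ a := ⟨q, hm, h⟩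
  exact eq_of_monic_of_associated (minpoly.monic hintegral) hm
    ((minpoly.prime_of_isIntegrallyClosed hintegral).irreducible.associated_of_dvd hq
      (minpoly.isIntegrallyClosed_dvd hintegral h))

theorem exists_numberField_root_quintic : ∃ (K : Type) (_ : Field K) (_ : NumberField K) (r : 𝓞 K),
    minpoly ℤ r = quintic ∧ Algebra.adjoin ℚ {(r : K)} = ⊤ ∧ Module.finrank ℚ K = 5 := by
  have hirr : Irreducible (quintic.map (Int.castRingHom ℚ)) :=
    (monic_quintic.irreducible_iff_irreducible_map_fraction_map).1 irreducible_quintic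
  have : Fact (Irreducible (quintic.map (Int.castRingHom ℚ))) := ⟨hirr⟩
  let K := AdjoinRoot (quintic.map (Int.castRingHom ℚ))
  let pb := AdjoinRoot.powerBasis hirr.ne_zero
  have : FiniteDimensional ℚ K := pb.finite
  have : CharZero K := algebraRat.charZero K
  have : NumberField K := ⟨⟩
  have hroot : aeval (AdjoinRoot.root (quintic.map (Int.castRingHom ℚ))) quintic = 0 := by
    have := AdjoinRoot.eval₂_root (quintic.map (Int.castRingHom ℚ))
    rw [eval₂_map] at this
    rwa [aeval_def, Subsingleton.elim (algebraMap ℤ K)]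
  have hintegral : IsIntegral ℤ (AdjoinRoot.root (quintic.map (Int.castRingHom ℚ))) :=
    ⟨quintic, monic_quintic, hroot⟩
  refine ⟨K, inferInstance, this, ⟨_, hintegral⟩, ?_, AdjoinRoot.adjoinRoot_eq_top, ?_⟩
  · refine minpoly_int_eq_of_irreducible irreducible_quintic monic_quintic ?_
    refine RingOfIntegers.coe_injective ?_
    exact (aeval_algebraMap_apply K (⟨_, hintegral⟩ : 𝓞 K) quintic).symm.trans
      (hroot.trans (map_zero _).symm)
  · rw [pb.finrank]
    simp [pb, natDegree_quintic, monic_quintic.natDegree_map]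

theorem root_quintic_eq_zero {K : Type*} [Field K] {r : 𝓞 K} (hr : minpoly ℤ r = quintic) :
    r ^ 5 - 5 * r ^ 4 - 10 * r ^ 3 + 50 * r ^ 2 + 25 * r - 15 = 0 := by
  have := minpoly.aeval ℤ r
  rw [hr, quintic] at this
  simpa [map_ofNat] using this

section

variable {K : Type*} [Field K] [NumberField K] {r : 𝓞 K}

theorem smul_mem_adjoin_root (hr : minpoly ℤ r = quintic) (hK : Algebra.adjoin ℚ {(r : K)} = ⊤)
    (z : 𝓞 K) : 198 * z ∈ Algebra.adjoin ℤ {r} := by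
  have hcond : aeval r (derivative (minpoly ℤ r)) ∈ conductor ℤ r := by
    have hle : Ideal.span {aeval r (derivative (minpoly ℤ r))} ≤ conductor ℤ r := by
      rw [← conductor_mul_differentIdeal ℤ ℚ K r hK]
      exact Ideal.mul_le_left
    exact hle (Ideal.mem_span_singleton_self _)
  have hder : aeval r (derivative (minpoly ℤ r)) =
      5 * r ^ 4 - 20 * r ^ 3 - 30 * r ^ 2 + 100 * r + 25 := by
    rw [hr, quintic_eq]
    simp [map_ofNat]
    ring
  have hz : 5 ^ 2 * (198 * z) ∈ Algebra.adjoin ℤ {r} := by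
    have := (mem_conductor_iff.1 (hder ▸ hcond))
      ((128 + 23 * (r - 1) - 64 * (r - 1) ^ 2 + 4 * (r - 1) ^ 4) * z)
    convert this using 1
    linear_combination (-20 * r ^ 3 + 60 * r ^ 2 + 100 * r - 255) * z * root_quintic_eq_zero hr
  have hintegral : IsIntegral ℚ (r : K) := Algebra.IsIntegral.isIntegral _
  let B : PowerBasis ℚ K := PowerBasis.ofAdjoinEqTop hintegral hK
  have hB : B.gen = r := PowerBasis.ofAdjoinEqTop_gen hintegral hK
  have hmem (a : 𝓞 K) : a ∈ Algebra.adjoin ℤ {r} ↔ (a : K) ∈ Algebra.adjoin ℤ {B.gen} := by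
    let φ := IsScalarTower.toAlgHom ℤ (𝓞 K) K
    have hφ : Algebra.adjoin ℤ {B.gen} = (Algebra.adjoin ℤ {r}).map φ := by
      rw [hB, AlgHom.map_adjoin_singleton]
      rfl
    rw [hφ]
    exact (Subalgebra.mem_map.trans ⟨fun ⟨b, hb, h⟩ ↦ RingOfIntegers.coe_injective h ▸ hb,
      fun h ↦ ⟨a, h, rfl⟩⟩).symm
  have hmin : minpoly ℤ B.gen = quintic := by
    rw [hB, ← hr]
    exact minpoly.algebraMap_eq RingOfIntegers.coe_injective r
  rw [hmem]
  refine mem_adjoin_of_smul_prime_pow_smul_of_minpoly_isEisensteinAt prime_five_int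
    (hB ▸ r.isIntegral_coe) (198 * z).isIntegral_coe (n := 2) ?_ (hmin ▸ isEisensteinAt_quintic)
  rw [hmem] at hz
  rw [zsmul_eq_mul]
  exact_mod_cast hz

theorem exists_ringHom_of_root (hr : minpoly ℤ r = quintic)
    (hK : Algebra.adjoin ℚ {(r : K)} = ⊤) {R : Type*} [CommRing R] (hR : IsUnit (198 : R))
    {a : R} (ha : aeval a quintic = 0) : ∃ φ : 𝓞 K →+* R, φ r = a := by
  have hwd (p q : ℤ[X]) (h : aeval r p = aeval r q) : aeval a p = aeval a q := by
    rw [← sub_eq_zero, ← map_sub] at h ⊢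
    obtain ⟨c, hc⟩ := minpoly.isIntegrallyClosed_dvd r.isIntegral h
    rw [hc, hr, map_mul, ha, zero_mul]
  have hex (z : 𝓞 K) : ∃ p : ℤ[X], aeval r p = 198 * z := by
    have := smul_mem_adjoin_root hr hK z
    rwa [Algebra.adjoin_singleton_eq_range_aeval] at this
  choose p hp using hex
  obtain ⟨d, hd⟩ := hR.exists_left_inv
  have hval (z : 𝓞 K) (q : ℤ[X]) (h : aeval r q = z) : d * aeval a (p z) = aeval a q := by
    rw [hwd (p z) (198 * q) (by rw [hp, map_mul, h, map_ofNat]), map_mul, map_ofNat, ← mul_assoc,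
      hd, one_mul]
  refine ⟨⟨⟨⟨fun z ↦ d * aeval a (p z), ?_⟩, fun z w ↦ ?_⟩, ?_, fun z w ↦ ?_⟩, ?_⟩
  · simpa using hval 1 1 (by simp)
  · have := hwd (p z * p w) (198 * p (z * w)) (by simp only [map_mul, map_ofNat, hp]; ring)
    simp only [map_mul, map_ofNat] at this
    linear_combination (-d) * d * this - d * aeval a (p (z * w)) * hd
  · simpa using hval 0 0 (by simp)
  · have := hwd (p (z + w)) (p z + p w) (by simp only [map_add, hp]; ring)
    simp only [this, map_add, mul_add]
  · simpa using hval r X (by simp)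

end


theorem zpow_sum_eq_prod {G ι : Type*} [CommGroup G] (a : G) (s : Finset ι) (f : ι → ℤ) :
    a ^ (∑ i ∈ s, f i) = ∏ i ∈ s, a ^ f i := by
  classical
  induction s using Finset.induction_on with
  | empty => simp
  | insert i s hi ih => rw [Finset.sum_insert hi, Finset.prod_insert hi, zpow_add, ih]

theorem units_rank_lt_finrank (K : Type*) [Field K] [NumberField K] :
    rank K < finrank ℚ K := by
  have h1 := InfinitePlace.card_add_two_mul_card_eq_rank K
  have h2 := InfinitePlace.card_eq_nrRealPlaces_add_nrComplexPlaces K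
  have h3 : 0 < Fintype.card (InfinitePlace K) := Fintype.card_pos
  unfold rank
  omega

theorem exists_prod_units_pow_eq_pow {K : Type*} [Field K] [NumberField K]
    (hK : Odd (finrank ℚ K)) {p : ℕ} [Fact p.Prime] (hp : Odd p) {ι : Type*} [Fintype ι]
    (u : ι → (𝓞 K)ˣ) (hι : finrank ℚ K ≤ Fintype.card ι) :
    ∃ n : ι → ℕ, (∃ i, ¬ p ∣ n i) ∧ ∃ v : (𝓞 K)ˣ, ∏ i, u i ^ n i = v ^ p := by
  have hu (i : ι) : ∃ e : Fin (rank K) → ℤ, ∃ ζ : (𝓞 K)ˣ, ζ ^ p = ζ ∧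
      u i = ζ * ∏ j, fundSystem K j ^ e j := by
    obtain ⟨⟨ζ, e⟩, h, -⟩ := exist_unique_eq_mul_prod K (u i)
    refine ⟨e, ζ, ?_, h⟩
    rcases torsion_eq_one_or_neg_one_of_odd_finrank hK ζ with h | h <;> rw [h]
    · simp
    · exact hp.neg_one_pow
  choose e ζ hζ hu using hu
  have hdep : ¬ LinearIndependent (ZMod p) fun i j ↦ (e i j : ZMod p) := fun h ↦ by
    have := h.fintype_card_le_finrank
    have := units_rank_lt_finrank K
    simp only [finrank_fintype_fun_eq_card, Fintype.card_fin] at *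
    omega
  obtain ⟨g, hg, i, hi⟩ := Fintype.not_linearIndependent_iff.1 hdep
  have hdvd (j : Fin (rank K)) : (p : ℤ) ∣ ∑ i, (g i).val * e i j := by
    rw [← ZMod.intCast_zmod_eq_zero_iff_dvd]
    simpa using congrFun hg j
  choose c hc using hdvd
  refine ⟨fun i ↦ (g i).val, ⟨i, fun h ↦ hi ?_⟩, (∏ i, ζ i ^ (g i).val) * ∏ j, fundSystem K j ^ c j,
      ?_⟩
  · rwa [← ZMod.natCast_eq_zero_iff, ZMod.natCast_zmod_val] at h
  · rw [mul_pow, ← Finset.prod_pow, ← Finset.prod_pow]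
    have h1 : ∏ i, (ζ i ^ (g i).val) ^ p = ∏ i, ζ i ^ (g i).val :=
      Finset.prod_congr rfl fun i _ ↦ by rw [pow_right_comm, hζ]
    have h2 (j : Fin (rank K)) :
        (fundSystem K j ^ c j) ^ p = ∏ i, (fundSystem K j ^ e i j) ^ (g i).val := by
      rw [← zpow_natCast, ← zpow_mul, mul_comm, ← hc, zpow_sum_eq_prod]
      exact Finset.prod_congr rfl fun i _ ↦ by rw [mul_comm, zpow_mul, zpow_natCast]
    simp_rw [h1, h2]
    rw [Finset.prod_comm, ← Finset.prod_mul_distrib]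
    exact Finset.prod_congr rfl fun i _ ↦ by rw [hu i, mul_pow, Finset.prod_pow]

/-- The multiplication table of the integral basis `1, s, s ^ 2, t, s * t` of the quintic field. -/
structure IsQuinticPair {R : Type*} [CommRing R] (s t : R) : Prop where
  pow_three : s ^ 3 = 1 + s ^ 2 - 3 * t
  sq_mul : s ^ 2 * t = 9 + 27 * s - 6 * s ^ 2 + 19 * t - s * t
  sq_right : t ^ 2 = 8 + 15 * s - 11 * s ^ 2 + 7 * t - 7 * (s * t)

/-- The element with given coordinates with respect to `1, s, s ^ 2, t, s * t`. -/
def quinticElt {R : Type*} [CommRing R] (s t a b c d e : R) : R :=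
  a + b * s + c * s ^ 2 + d * t + e * (s * t)

theorem map_quinticElt {R S : Type*} [CommRing R] [CommRing S] (φ : R →+* S) (s t a b c d e : R) :
    φ (quinticElt s t a b c d e) = quinticElt (φ s) (φ t) (φ a) (φ b) (φ c) (φ d) (φ e) := by
  simp [quinticElt]

theorem IsQuinticPair.mul {R : Type*} [CommRing R] {s t : R} (h : IsQuinticPair s t)
    (a b c d e a₂ b₂ c₂ d₂ e₂ : R) :
    quinticElt s t a b c d e * quinticElt s t a₂ b₂ c₂ d₂ e₂ =
      quinticElt s t
        (a * a₂ + b * c₂ + c * b₂ + c * c₂ + 9 * (b * e₂ + e * b₂ + c * d₂ + d * c₂) -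
          15 * (c * e₂ + e * c₂) + 8 * d * d₂ - 74 * (d * e₂ + e * d₂) + 172 * e * e₂)
        (a * b₂ + b * a₂ + c * c₂ + 27 * (b * e₂ + e * b₂ + c * d₂ + d * c₂) -
          18 * (c * e₂ + e * c₂) + 15 * d * d₂ - 181 * (d * e₂ + e * d₂) + 304 * e * e₂)
        (a * c₂ + c * a₂ + b * b₂ + b * c₂ + c * b₂ + c * c₂ -
          6 * (b * e₂ + e * b₂ + c * d₂ + d * c₂) + 27 * (c * e₂ + e * c₂) - 11 * d * d₂ +
          46 * (d * e₂ + e * d₂) - 219 * e * e₂)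
        (a * d₂ + d * a₂ - 3 * (b * c₂ + c * b₂ + c * c₂) +
          19 * (b * e₂ + e * b₂ + c * d₂ + d * c₂) - (c * e₂ + e * c₂) + 7 * d * d₂ -
          100 * (d * e₂ + e * d₂) + 128 * e * e₂)
        (a * e₂ + e * a₂ + b * d₂ + d * b₂ - 3 * c * c₂ - (b * e₂ + e * b₂ + c * d₂ + d * c₂) +
          20 * (c * e₂ + e * c₂) - 7 * d * d₂ + 14 * (d * e₂ + e * d₂) - 114 * e * e₂) := by
  obtain ⟨h1, h2, h3⟩ := h
  unfold quinticElt
  linear_combination (b * c₂ + c * b₂ + c * c₂ * (s + 1)) * h1 +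
    (b * e₂ + e * b₂ + c * d₂ + d * c₂) * h2 + d * d₂ * h3 +
    (c * e₂ + e * c₂) * (t * h1 + h2 - 3 * h3) + (d * e₂ + e * d₂) * (s * h3 - 11 * h1 - 7 * h2) +
    e * e₂ * (t * h2 - 6 * h2 + 19 * h3 - (s * h3 - 11 * h1 - 7 * h2))

theorem exists_isQuinticPair {K : Type*} [Field K] [CharZero K] (s : 𝓞 K)
    (hs : s ^ 5 - 20 * s ^ 3 + 80 * s + 46 = 0) : ∃ t : 𝓞 K, IsQuinticPair s t := by
  have hsK : (s : K) ^ 5 - 20 * (s : K) ^ 3 + 80 * s + 46 = 0 := by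
    simpa [map_ofNat] using congrArg (algebraMap (𝓞 K) K) hs
  have hintegral : IsIntegral ℤ ((1 + (s : K) ^ 2 - (s : K) ^ 3) / 3) := by
    refine ⟨X ^ 5 + C (-15) * X ^ 4 + C (-300) * X ^ 3 + C 80 * X ^ 2 + C 4295 * X + C (-2361),
      by monicity!, ?_⟩
    generalize (s : K) = s at *
    simp only [eval₂_add, eval₂_mul, eval₂_pow, eval₂_X, eval₂_C]
    simp only [eq_intCast]
    push_cast
    linear_combination ((-4922/243) + (8560/243) * s + (-2470/81) * s ^ 2 + (1090/81) * s ^ 3 +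
      (-700/81) * s ^ 4 + (269/81) * s ^ 5 + (-365/243) * s ^ 6 + (70/243) * s ^ 7 +
      (-10/81) * s ^ 8 + (5/243) * s ^ 9 + (-1/243) * s ^ 10) * hsK
  obtain ⟨t, ht⟩ : ∃ t : 𝓞 K, (t : K) = (1 + (s : K) ^ 2 - (s : K) ^ 3) / 3 := ⟨⟨_, hintegral⟩, rfl⟩
  refine ⟨t, ?_, ?_, ?_⟩ <;> apply RingOfIntegers.coe_injective <;>
    simp only [map_add, map_sub, map_mul, map_pow, map_one, map_ofNat, ht]
  · ring
  · linear_combination (-1 / 3) * hsK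
  · linear_combination ((s - 2) / 9) * hsK

/-- `π` generates a copy of the truncated polynomial ring `𝔽₅[π] / (π ^ 5)`. -/
structure IsTruncatedVariable {R : Type*} [CommRing R] [Algebra (ZMod 5) R] (π : R) : Prop where
  pow_five : π ^ 5 = 0
  eq_zero : ∀ a b c d e : ZMod 5, algebraMap _ R a + algebraMap _ R b * π +
    algebraMap _ R c * π ^ 2 + algebraMap _ R d * π ^ 3 + algebraMap _ R e * π ^ 4 = 0 →
    a = 0 ∧ b = 0 ∧ c = 0 ∧ d = 0 ∧ e = 0

theorem exists_isTruncatedVariable : ∃ (R : Type) (_ : CommRing R) (_ : Algebra (ZMod 5) R)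
    (_ : CharP R 5) (π : R), IsTruncatedVariable π := by
  have h5 : Fact (Nat.Prime 5) := ⟨by norm_num⟩
  let R := AdjoinRoot (X ^ 5 : (ZMod 5)[X])
  have hdvd (p : (ZMod 5)[X]) : AdjoinRoot.mk (X ^ 5) p = 0 ↔ ∀ i < 5, p.coeff i = 0 := by
    rw [AdjoinRoot.mk_eq_zero, X_pow_dvd_iff]
  have hnt : Nontrivial R := ⟨1, 0, fun h ↦ by
    simpa using (hdvd 1).1 h 0 (by norm_num)⟩
  refine ⟨R, inferInstance, inferInstance,
    charP_of_injective_algebraMap (algebraMap (ZMod 5) R).injective 5,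
    AdjoinRoot.mk _ X, ?_, fun a b c d e h ↦ ?_⟩
  · rw [← map_pow, AdjoinRoot.mk_self]
  · have hcase := (hdvd (C a + C b * X + C c * X ^ 2 + C d * X ^ 3 + C e * X ^ 4)).1 (by
      simpa [R, AdjoinRoot.algebraMap_eq] using h)
    refine ⟨?_, ?_, ?_, ?_, ?_⟩
    · simpa [coeff_X, coeff_X_pow, coeff_C] using hcase 0
    · simpa [coeff_X, coeff_X_pow, coeff_C] using hcase 1
    · simpa [coeff_X, coeff_X_pow, coeff_C] using hcase 2
    · simpa [coeff_X, coeff_X_pow, coeff_C] using hcase 3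
    · simpa [coeff_X, coeff_X_pow, coeff_C] using hcase 4

section Truncated

variable {R : Type*} [CommRing R] {π : R}

theorem cube_mul_add_pow (hπ : π ^ 5 = 0) (a b c d : R) (n : ℕ) :
    π ^ 3 * (1 + a * π + b * π ^ 2 + c * π ^ 3 + d * π ^ 4) ^ n = π ^ 3 + n * a * π ^ 4 := by
  induction n with
  | zero => simp
  | succ n ih =>
    rw [pow_succ _ n, ← mul_assoc, ih]
    push_cast
    linear_combination (b + c * π + d * π ^ 2 + n * a * (a + b * π + c * π ^ 2 + d * π ^ 3)) * hπ

theorem one_add_cube_pow (hπ : π ^ 5 = 0) (a b : R) (n : ℕ) :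
    (1 + a * π ^ 3 + b * π ^ 4) ^ n = 1 + n * a * π ^ 3 + n * b * π ^ 4 := by
  induction n with
  | zero => simp
  | succ n ih =>
    rw [pow_succ _ n, ih]
    push_cast
    linear_combination (n * a * π * a + n * a * b * π ^ 2 + n * b * a * π ^ 2 +
        n * b * b * π ^ 3) * hπ

variable [Algebra (ZMod 5) R] [CharP R 5]

theorem five_dvd_of_truncated_relation (hπ : IsTruncatedVariable π) {k m n : ℕ} {x : ZMod 5}
    (h : (1 + π + 2 * π ^ 2 + 2 * π ^ 3) ^ k * (1 + 2 * π ^ 3 + π ^ 4) ^ m * (1 + 3 * π ^ 4) ^ n =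
      algebraMap (ZMod 5) R x) : 5 ∣ k ∧ 5 ∣ m ∧ 5 ∣ n := by
  have hπ5 := hπ.pow_five
  have hk : 5 ∣ k := by
    have h1 := cube_mul_add_pow hπ5 1 2 2 0 k
    have h2 := cube_mul_add_pow hπ5 0 0 2 1 m
    have h3 := cube_mul_add_pow hπ5 0 0 0 3 n
    simp only [one_mul, mul_one, zero_mul, mul_zero, add_zero] at h1 h2 h3
    have hx : π ^ 3 + k * π ^ 4 = algebraMap (ZMod 5) R x * π ^ 3 := by
      rw [← h]
      linear_combination -(1 + 2 * π ^ 3 + π ^ 4) ^ m * (1 + 3 * π ^ 4) ^ n * h1 -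
        (1 + 3 * π ^ 4) ^ n * (1 + k * π) * h2 - (1 + k * π) * h3
    obtain ⟨-, -, -, -, h⟩ := hπ.eq_zero 0 0 0 (1 - x) k (by
      simp only [map_zero, map_sub, map_one, map_natCast]
      linear_combination hx)
    exact (ZMod.natCast_eq_zero_iff _ _).1 h
  have hone : (1 + π + 2 * π ^ 2 + 2 * π ^ 3) ^ k = 1 := by
    obtain ⟨j, rfl⟩ := hk
    have : (1 + π + 2 * π ^ 2 + 2 * π ^ 3) ^ 5 = 1 := by
      have : Fact (Nat.Prime 5) := ⟨by norm_num⟩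
      rw [add_pow_char, add_pow_char, add_pow_char]
      linear_combination (1 + 32 * π ^ 5 + 32 * π ^ 10) * hπ5
    rw [pow_mul, this, one_pow]
  have hm := one_add_cube_pow hπ5 2 1 m
  have hn := one_add_cube_pow hπ5 0 3 n
  simp only [one_mul, mul_one, zero_mul, mul_zero, add_zero] at hm hn
  rw [hone, hm, hn] at h
  obtain ⟨-, -, -, h3, h4⟩ := hπ.eq_zero (1 - x) 0 0 (m * 2) (m + n * 3) (by
    simp only [map_zero, map_sub, map_add, map_mul, map_one, map_natCast, map_ofNat]
    linear_combination h - (m * 2 * n * 3 * π ^ 2 + m * n * 3 * π ^ 3) * hπ5)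
  refine ⟨hk, ?_, ?_⟩ <;> rw [← ZMod.natCast_eq_zero_iff]
  · linear_combination 3 * h3 - (m : ZMod 5) * (by decide : (5 : ZMod 5) = 0)
  · linear_combination 2 * h4 - h3 - (n : ZMod 5) * (by decide : (5 : ZMod 5) = 0)

variable {K : Type*} [Field K] [NumberField K] {r : 𝓞 K}

theorem exists_map_pow_five_eq_algebraMap (hr : minpoly ℤ r = quintic)
    (hK : Algebra.adjoin ℚ {(r : K)} = ⊤) (hπ : π ^ 5 = 0) (φ : 𝓞 K →+* R) (hφ : φ r = π)
    (v : 𝓞 K) : ∃ x : ZMod 5, φ v ^ 5 = algebraMap (ZMod 5) R x := by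
  have : Fact (Nat.Prime 5) := ⟨by norm_num⟩
  have h5 : (5 : R) = 0 := by exact_mod_cast CharP.cast_eq_zero R 5
  have hv := smul_mem_adjoin_root hr hK v
  rw [Algebra.adjoin_singleton_eq_range_aeval] at hv
  obtain ⟨p, hp⟩ := hv
  have hpφ : aeval π p = 198 * φ v := by
    have := congrArg φ.toIntAlgHom hp
    change φ.toIntAlgHom (aeval r p) = _ at this
    rw [← aeval_algHom_apply] at this
    simpa [hφ, map_ofNat] using this
  have hfrob : aeval π p ^ 5 = (p.coeff 0 : R) := by
    have := aeval_algHom_apply (frobenius R 5).toIntAlgHom π p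
    simp only [RingHom.toIntAlgHom_apply, frobenius_def, hπ] at this
    rw [← this, aeval_def, eval₂_at_zero, eq_intCast]
  refine ⟨2 * p.coeff 0, ?_⟩
  rw [map_mul, map_intCast, ← hfrob, hpφ, map_ofNat]
  linear_combination -121726726387 * φ v ^ 5 * h5

end Truncated

theorem IsQuinticPair.exists_units {R : Type*} [CommRing R] {s t : R} (h : IsQuinticPair s t) :
    ∃ ε₁ ε₂ ε₃ ε₄ : Rˣ, (ε₁ : R) = quinticElt s t (-2) (-4) 0 (-1) 0 ∧
      (ε₂ : R) = quinticElt s t (-19) 6 9 4 2 ∧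
      (ε₃ : R) = quinticElt s t (-39) (-120) (-10) (-70) (-15) ∧
      (ε₄ : R) = quinticElt s t 446 375 (-10) 105 15 := by
  refine ⟨Units.mkOfMulEqOne (quinticElt s t (-2) (-4) 0 (-1) 0)
      (quinticElt s t (-1471) (-275) 391 22 61) ?_,
    Units.mkOfMulEqOne (quinticElt s t (-19) 6 9 4 2)
      (quinticElt s t (-104) (-311) (-34) (-169) (-37)) ?_,
    Units.mkOfMulEqOne (quinticElt s t (-39) (-120) (-10) (-70) (-15))
      (quinticElt s t (-359) (-405) 235 (-30) 40) ?_,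
    Units.mkOfMulEqOne (quinticElt s t 446 375 (-10) 105 15)
      (quinticElt s t 395831 500300 (-281315) 38670 (-48090)) ?_,
    rfl, rfl, rfl, rfl⟩ <;> rw [h.mul] <;> norm_num [quinticElt]

theorem five_dvd_of_pow_eq_one {p : ℕ} [Fact p.Prime] {ζ : ZMod p} (h5 : ζ ^ 5 = 1) (h1 : ζ ≠ 1)
    {n : ℕ} (hn : ζ ^ n = 1) : 5 ∣ n := by
  have : Fact (Nat.Prime 5) := ⟨by norm_num⟩
  rw [← orderOf_eq_prime h5 h1]
  exact orderOf_dvd_of_pow_eq_one hn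

theorem five_dvd_of_quintic_residue {p m : ℕ} [Fact p.Prime] (hp : p - 1 = 5 * m)
    {a b v ζ : ZMod p} {i j k l : ℕ} (hv : v ≠ 0) (ha : a ^ m = ζ ^ i) (hb : b ^ m = ζ ^ j)
    (h5 : ζ ^ 5 = 1) (h1 : ζ ≠ 1) (h : a ^ k * b ^ l = v ^ 5) : 5 ∣ i * k + j * l := by
  refine five_dvd_of_pow_eq_one h5 h1 ?_
  calc ζ ^ (i * k + j * l) = (a ^ m) ^ k * (b ^ m) ^ l := by rw [ha, hb]; ring
    _ = (a ^ k * b ^ l) ^ m := by ring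
    _ = v ^ (p - 1) := by rw [h, hp, pow_mul]
    _ = 1 := ZMod.pow_card_sub_one_eq_one hv

instance fact_prime_forty_one : Fact (Nat.Prime 41) := ⟨by norm_num⟩

instance fact_prime_sixty_one : Fact (Nat.Prime 61) := ⟨by norm_num⟩

theorem isUnit_ofNat_of_coprime {R : Type*} [CommRing R] {p : ℕ} [CharP R p]
    (hp : Nat.Coprime 198 p) : IsUnit (198 : R) := by
  have := (ZMod.unitOfCoprime 198 hp).isUnit.map (ZMod.castHom dvd_rfl R)
  simpa [map_ofNat] using this

section Units

variable {K : Type*} [Field K] {r t : 𝓞 K}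

theorem five_dvd_of_pow_mul_pow_eq_pow [NumberField K] (hr : minpoly ℤ r = quintic)
    (hK : Algebra.adjoin ℚ {(r : K)} = ⊤) (ht : IsQuinticPair (r - 1) t) (v : (𝓞 K)ˣ) {k l : ℕ}
    (h : quinticElt (r - 1) t (-39) (-120) (-10) (-70) (-15) ^ k *
      quinticElt (r - 1) t 446 375 (-10) 105 15 ^ l = v ^ 5) : 5 ∣ k ∧ 5 ∣ l := by
  have h41 : 5 ∣ 1 * k + 2 * l := by
    obtain ⟨ψ, hψ⟩ := exists_ringHom_of_root hr hK (R := ZMod 41) (a := 20)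
      (isUnit_ofNat_of_coprime (p := 41) (by norm_num))
      (by simp [quintic, map_ofNat]; decide)
    have hψt : ψ t = 14 * (1 + 19 ^ 2 - 19 ^ 3) := by
      have := congrArg ψ ht.pow_three
      simp only [map_add, map_sub, map_mul, map_pow, map_one, map_ofNat, hψ] at this
      have h0 : (41 : ZMod 41) = 0 := by decide
      linear_combination 14 * this - ψ t * h0
    have hcase := congrArg ψ h
    simp only [map_mul, map_pow, map_quinticElt, map_sub, map_neg, map_one, map_ofNat, hψ, hψt]
      at hcase
    exact five_dvd_of_quintic_residue (m := 8) (ζ := 23 ^ 8) (by norm_num) (v.isUnit.map ψ).ne_zero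
      (by decide) (by decide) (by decide) (by decide) hcase
  have h61 : 5 ∣ 1 * k + 1 * l := by
    obtain ⟨ψ, hψ⟩ := exists_ringHom_of_root hr hK (R := ZMod 61) (a := 8)
      (isUnit_ofNat_of_coprime (p := 61) (by norm_num))
      (by simp [quintic, map_ofNat]; decide)
    have hψt : ψ t = -20 * (1 + 7 ^ 2 - 7 ^ 3) := by
      have := congrArg ψ ht.pow_three
      simp only [map_add, map_sub, map_mul, map_pow, map_one, map_ofNat, hψ] at this
      have h0 : (61 : ZMod 61) = 0 := by decide
      linear_combination -20 * this + ψ t * h0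
    have hcase := congrArg ψ h
    simp only [map_mul, map_pow, map_quinticElt, map_sub, map_neg, map_one, map_ofNat, hψ, hψt]
      at hcase
    exact five_dvd_of_quintic_residue (m := 12) (ζ := 5 ^ 12) (by norm_num) (v.isUnit.map ψ).ne_zero
      (by decide) (by decide) (by decide) (by decide) hcase
  omega

variable {R : Type*} [CommRing R] [CharP R 5] {π : R}

theorem IsQuinticPair.map_right_eq (ht : IsQuinticPair (r - 1) t) (φ : 𝓞 K →+* R)
    (hφ : φ r = π) : φ t = 1 + 3 * π ^ 2 + 3 * π ^ 3 := by
  have h5 : (5 : R) = 0 := by exact_mod_cast CharP.cast_eq_zero R 5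
  have := congrArg φ ht.pow_three
  simp only [map_add, map_sub, map_mul, map_pow, map_one, map_ofNat, hφ] at this
  linear_combination 2 * this + (-φ t + 1 - 2 * π + π ^ 2 - π ^ 3) * h5

theorem aeval_quintic_eq_zero (hπ : π ^ 5 = 0) : aeval π quintic = 0 := by
  have h5 : (5 : R) = 0 := by exact_mod_cast CharP.cast_eq_zero R 5
  simp only [quintic, map_add, map_sub, map_mul, map_pow, map_ofNat, aeval_X]
  linear_combination hπ + (-π ^ 4 - 2 * π ^ 3 + 10 * π ^ 2 + 5 * π - 3) * h5

theorem IsQuinticPair.map_fst_unit (ht : IsQuinticPair (r - 1) t) (φ : 𝓞 K →+* R)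
    (hφ : φ r = π) {ε : 𝓞 K} (hε : ε = quinticElt (r - 1) t (-2) (-4) 0 (-1) 0) :
    φ ε = 1 + π + 2 * π ^ 2 + 2 * π ^ 3 := by
  have h5 : (5 : R) = 0 := by exact_mod_cast CharP.cast_eq_zero R 5
  rw [hε, map_quinticElt, ht.map_right_eq φ hφ, quinticElt]
  simp only [map_sub, map_neg, map_zero, map_one, map_ofNat, hφ]
  linear_combination (-π - π ^ 2 - π ^ 3) * h5

theorem IsQuinticPair.map_snd_unit (ht : IsQuinticPair (r - 1) t) (φ : 𝓞 K →+* R)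
    (hφ : φ r = π) {ε : 𝓞 K} (hε : ε = quinticElt (r - 1) t (-19) 6 9 4 2) :
    φ ε = 1 + 2 * π ^ 3 + π ^ 4 := by
  have h5 : (5 : R) = 0 := by exact_mod_cast CharP.cast_eq_zero R 5
  rw [hε, map_quinticElt, ht.map_right_eq φ hφ, quinticElt]
  simp only [map_sub, map_neg, map_one, map_ofNat, hφ]
  linear_combination (-3 - 2 * π + 3 * π ^ 2 + 2 * π ^ 3 + π ^ 4) * h5

theorem map_unit_ne [NumberField K] [Algebra (ZMod 5) R] (hr : minpoly ℤ r = quintic)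
    (hK : Algebra.adjoin ℚ {(r : K)} = ⊤) (hfin : Module.finrank ℚ K = 5)
    (ht : IsQuinticPair (r - 1) t) (hπ : IsTruncatedVariable π) (φ : 𝓞 K →+* R) (hφ : φ r = π)
    (u : (𝓞 K)ˣ) : φ u ≠ 1 + 3 * π ^ 4 := by
  intro hu
  have : Fact (Nat.Prime 5) := ⟨by norm_num⟩
  have h5 : (5 : R) = 0 := by exact_mod_cast CharP.cast_eq_zero R 5
  obtain ⟨ε₁, ε₂, ε₃, ε₄, h1, h2, h3, h4⟩ := ht.exists_units
  obtain ⟨n, ⟨i, hi⟩, v, hv⟩ := exists_prod_units_pow_eq_pow (K := K) (p := 5)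
    (by rw [hfin]; decide) (by decide) ![ε₁, ε₂, ε₃, ε₄, u] (by simp [hfin])
  simp only [Fin.prod_univ_five, Matrix.cons_val] at hv
  have hφt := ht.map_right_eq φ hφ
  obtain ⟨x, hx⟩ := exists_map_pow_five_eq_algebraMap hr hK hπ.pow_five φ hφ v
  have hφ1 := ht.map_fst_unit φ hφ h1
  have hφ2 := ht.map_snd_unit φ hφ h2
  have hφ3 : φ ε₃ = 1 := by
    rw [h3, map_quinticElt, hφt, quinticElt]
    simp only [map_sub, map_neg, map_one, map_ofNat, hφ]
    linear_combination (3 - 23 * π - 35 * π ^ 2 - 42 * π ^ 3 - 9 * π ^ 4) * h5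
  have hφ4 : φ ε₄ = 1 := by
    rw [h4, map_quinticElt, hφt, quinticElt]
    simp only [map_sub, map_neg, map_one, map_ofNat, hφ]
    linear_combination (30 + 82 * π + 52 * π ^ 2 + 63 * π ^ 3 + 9 * π ^ 4) * h5
  have hrel := congrArg (fun w : (𝓞 K)ˣ ↦ φ w) hv
  simp only [Units.val_mul, Units.val_pow_eq_pow_val, map_mul, map_pow, hφ1, hφ2, hφ3, hφ4, hu,
    one_pow, mul_one, hx] at hrel
  obtain ⟨⟨a, ha⟩, ⟨b, hb⟩, ⟨c, hc⟩⟩ := five_dvd_of_truncated_relation hπ hrel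
  have hres : ε₃ ^ n 2 * ε₄ ^ n 3 = (v * (ε₁ ^ a * ε₂ ^ b * u ^ c)⁻¹) ^ 5 := by
    rw [mul_pow, ← hv, inv_pow, eq_mul_inv_iff_mul_eq, ha, hb, hc]
    simp only [mul_pow, ← pow_mul, mul_comm _ 5]
    ac_rfl
  obtain ⟨hn2, hn3⟩ := five_dvd_of_pow_mul_pow_eq_pow hr hK ht _ (k := n 2) (l := n 3) (by
    rw [← h3, ← h4]
    exact_mod_cast congrArg Units.val hres)
  fin_cases i <;> simp_all

end Units

theorem thue_mod_two : ∀ x y : ZMod 2,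
    x ^ 5 + 65 * x ^ 4 * y - 870 * x ^ 3 * y ^ 2 - 18990 * x ^ 2 * y ^ 3 +
      26325 * x * y ^ 4 + 255069 * y ^ 5 = 0 → x = y := by
  decide

theorem thue_mod_eighty_one : ∀ x y : ZMod 81,
    x ^ 5 + 65 * x ^ 4 * y - 870 * x ^ 3 * y ^ 2 - 18990 * x ^ 2 * y ^ 3 +
      26325 * x * y ^ 4 + 255069 * y ^ 5 = 0 → 27 * x = 0 ∨ x = 40 * y := by
  decide +kernel

theorem thue_mod_one_hundred_twenty_one : ∀ x y : ZMod 121,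
    x ^ 5 + 65 * x ^ 4 * y - 870 * x ^ 3 * y ^ 2 - 18990 * x ^ 2 * y ^ 3 +
      26325 * x * y ^ 4 + 255069 * y ^ 5 = 0 → 11 * x = 44 * y ∨ x = 29 * y := by
  decide +kernel

theorem thue_mod_eleven : ∀ τ y : ZMod 11,
    153 * y ^ 5 - 13585 * τ * y ^ 4 - 22550 * τ ^ 2 * y ^ 3 + 3630 * τ ^ 3 * y ^ 2 +
      10285 * τ ^ 4 * y + 1331 * τ ^ 5 ≠ -2592 := by
  decide +kernel

/-- A pair at which the norm form of a fixed rank-two sublattice is `1` gives a unit. -/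
theorem IsQuinticPair.exists_unit_of_norm_eq_one {R : Type*} [CommRing R] {s t : R}
    (h : IsQuinticPair s t) (w y : R) (hH : 13095432 * w ^ 5 + 201238560 * w ^ 4 * y +
        474819840 * w ^ 3 * y ^ 2 - 1656906240 * w ^ 2 * y ^ 3 - 5509807600 * w * y ^ 4 -
        3024230319 * y ^ 5 = 1) :
    ∃ u : Rˣ, (u : R) = quinticElt s t (-52 * w - 128 * y) (-95 * w - 226 * y) (16 * w + 40 * y)
        (-30 * w - 61 * y) (-3 * w + y) := by
  refine ⟨Units.mkOfMulEqOne (quinticElt s t (-52 * w - 128 * y) (-95 * w - 226 * y) (16 * w + 40 * y)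
      (-30 * w - 61 * y) (-3 * w + y))
    (quinticElt s t
      (-42109092 * w ^ 4 - 480086838 * w ^ 3 * y + 369617490 * w ^ 2 * y ^ 2 +
          3863041160 * w * y ^ 3 + 2464314556 * y ^ 4)
      (-8258760 * w ^ 4 - 91793682 * w ^ 3 * y + 71486712 * w ^ 2 * y ^ 2 + 744344931 * w * y ^ 3 +
          477124901 * y ^ 4)
      (11090952 * w ^ 4 + 127391778 * w ^ 3 * y - 97305912 * w ^ 2 * y ^ 2 -
          1026037892 * w * y ^ 3 - 654571159 * y ^ 4)
      (496260 * w ^ 4 + 6592158 * w ^ 3 * y - 4443318 * w ^ 2 * y ^ 2 - 51139924 * w * y ^ 3 -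
          31516749 * y ^ 4)
      (1710504 * w ^ 4 + 19781118 * w ^ 3 * y - 15120666 * w ^ 2 * y ^ 2 - 159448355 * w * y ^ 3 -
          101494074 * y ^ 4)) ?_, rfl⟩
  rw [h.mul, quinticElt]
  linear_combination hH

/-- The analogue of `exists_unit_of_norm_eq_one` for a second rank-two sublattice. -/
theorem IsQuinticPair.exists_unit_of_norm_eq_one' {R : Type*} [CommRing R] {s t : R}
    (h : IsQuinticPair s t) (w y : R) (hH : -14648 * w ^ 5 - 61320 * w ^ 4 * y +
        201760 * w ^ 3 * y ^ 2 + 169720 * w ^ 2 * y ^ 3 - 138950 * w * y ^ 4 - 23487 * y ^ 5 = 1) :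
    ∃ u : Rˣ, (u : R) = quinticElt s t (16 * w + 223 * y) (-25 * w + 14 * y) (6 * w - 47 * y)
        (-4 * w - 6 * y) (w - 7 * y) := by
  refine ⟨Units.mkOfMulEqOne (quinticElt s t (16 * w + 223 * y) (-25 * w + 14 * y) (6 * w - 47 * y)
      (-4 * w - 6 * y) (w - 7 * y))
    (quinticElt s t
      (976 * w ^ 4 + 11766 * w ^ 3 * y + 7972 * w ^ 2 * y ^ 2 - 306 * w * y ^ 3 + 1397 * y ^ 4)
      (4220 * w ^ 4 + 29490 * w ^ 3 * y + 17020 * w ^ 2 * y ^ 2 - 4635 * w * y ^ 3 + 3775 * y ^ 4)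
      (1692 * w ^ 4 + 9390 * w ^ 3 * y - 346 * w ^ 2 * y ^ 2 - 12496 * w * y ^ 3 - 1280 * y ^ 4)
      (1440 * w ^ 4 + 9818 * w ^ 3 * y + 6676 * w ^ 2 * y ^ 2 - 146 * w * y ^ 3 + 2442 * y ^ 4)
      (652 * w ^ 4 + 3778 * w ^ 3 * y - 894 * w ^ 2 * y ^ 2 - 5149 * w * y ^ 3 - 162 * y ^ 4))
    ?_, rfl⟩
  rw [h.mul, quinticElt]
  linear_combination hH

theorem norm_form_mod_twenty_five : ∀ w y : ZMod 25,
    13095432 * w ^ 5 + 201238560 * w ^ 4 * y + 474819840 * w ^ 3 * y ^ 2 -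
        1656906240 * w ^ 2 * y ^ 3 - 5509807600 * w * y ^ 4 - 3024230319 * y ^ 5 = 1 →
      ZMod.castHom (by decide : 5 ∣ 25) (ZMod 5) w = 3 ∧
      ZMod.castHom (by decide : 5 ∣ 25) (ZMod 5) y = 0 := by
  decide +kernel

theorem norm_form_mod_twenty_five' : ∀ w y : ZMod 25,
    -14648 * w ^ 5 - 61320 * w ^ 4 * y + 201760 * w ^ 3 * y ^ 2 + 169720 * w ^ 2 * y ^ 3 -
        138950 * w * y ^ 4 - 23487 * y ^ 5 = 1 →
      ZMod.castHom (by decide : 5 ∣ 25) (ZMod 5) w = 4 ∧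
      ZMod.castHom (by decide : 5 ∣ 25) (ZMod 5) y = 1 := by
  decide +kernel

theorem norm_form_ne_one (w y : ℤ) :
    13095432 * w ^ 5 + 201238560 * w ^ 4 * y + 474819840 * w ^ 3 * y ^ 2 -
        1656906240 * w ^ 2 * y ^ 3 - 5509807600 * w * y ^ 4 - 3024230319 * y ^ 5 ≠ 1 := by
  intro h
  obtain ⟨K, _, _, r, hr, hK, hfin⟩ := exists_numberField_root_quintic
  obtain ⟨R, _, _, _, π, hπ⟩ := exists_isTruncatedVariable
  have h5 : (5 : R) = 0 := by exact_mod_cast CharP.cast_eq_zero R 5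
  have hroot := root_quintic_eq_zero hr
  obtain ⟨t, ht⟩ := exists_isQuinticPair (r - 1) (by linear_combination hroot)
  obtain ⟨φ, hφ⟩ := exists_ringHom_of_root hr hK (R := R) (a := π)
    (isUnit_ofNat_of_coprime (p := 5) (by norm_num)) (aeval_quintic_eq_zero hπ.pow_five)
  have hφt := ht.map_right_eq φ hφ
  obtain ⟨u, hu⟩ := ht.exists_unit_of_norm_eq_one (w : 𝓞 K) y (by exact_mod_cast h)
  obtain ⟨hw, hy⟩ := norm_form_mod_twenty_five w y
    (by exact_mod_cast congrArg (Int.cast (R := ZMod 25)) h)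
  rw [map_intCast] at hw hy
  have hwR : (w : R) = 3 := by simpa [map_ofNat] using congrArg (algebraMap (ZMod 5) R) hw
  have hyR : (y : R) = 0 := by simpa [map_ofNat] using congrArg (algebraMap (ZMod 5) R) hy
  refine map_unit_ne hr hK hfin ht hπ φ hφ u ?_
  rw [hu, map_quinticElt, hφt, quinticElt]
  simp only [map_add, map_sub, map_mul, map_neg, map_one, map_ofNat, map_intCast, hφ, hwR, hyR]
  linear_combination (1 + 3 * (6 - 26 * π - 13 * π ^ 2 - 18 * π ^ 3 - 2 * π ^ 4)) * h5

theorem norm_form_ne_one' (w y : ℤ) :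
    -14648 * w ^ 5 - 61320 * w ^ 4 * y + 201760 * w ^ 3 * y ^ 2 + 169720 * w ^ 2 * y ^ 3 -
        138950 * w * y ^ 4 - 23487 * y ^ 5 ≠ 1 := by
  intro h
  obtain ⟨K, _, _, r, hr, hK, hfin⟩ := exists_numberField_root_quintic
  obtain ⟨R, _, _, _, π, hπ⟩ := exists_isTruncatedVariable
  have h5 : (5 : R) = 0 := by exact_mod_cast CharP.cast_eq_zero R 5
  have hroot := root_quintic_eq_zero hr
  obtain ⟨t, ht⟩ := exists_isQuinticPair (r - 1) (by linear_combination hroot)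
  obtain ⟨φ, hφ⟩ := exists_ringHom_of_root hr hK (R := R) (a := π)
    (isUnit_ofNat_of_coprime (p := 5) (by norm_num)) (aeval_quintic_eq_zero hπ.pow_five)
  have hφt := ht.map_right_eq φ hφ
  obtain ⟨u, hu⟩ := ht.exists_unit_of_norm_eq_one' (w : 𝓞 K) y (by exact_mod_cast h)
  obtain ⟨hw, hy⟩ := norm_form_mod_twenty_five' w y
    (by exact_mod_cast congrArg (Int.cast (R := ZMod 25)) h)
  rw [map_intCast] at hw hy
  have hwR : (w : R) = 4 := by simpa [map_ofNat] using congrArg (algebraMap (ZMod 5) R) hw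
  have hyR : (y : R) = 1 := by simpa [map_ofNat] using congrArg (algebraMap (ZMod 5) R) hy
  obtain ⟨ε₁, ε₂, -, -, h1, h2, -⟩ := ht.exists_units
  have hφu : φ u = 1 + 2 * π + 4 * π ^ 3 + π ^ 4 := by
    rw [hu, map_quinticElt, hφt, quinticElt]
    simp only [map_add, map_sub, map_mul, map_neg, map_one, map_ofNat, map_intCast, hφ, hwR, hyR]
    linear_combination (2 + 3 * π + π ^ 2 + 2 * π ^ 3 + 3 * π ^ 4 +
      4 * (8 - 8 * π - 2 * π ^ 2 - 3 * π ^ 3) +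
      (32 + 20 * π - 9 * π ^ 2 - 4 * π ^ 3 - 5 * π ^ 4)) * h5
  refine map_unit_ne hr hK hfin ht hπ φ hφ (u * ε₁ ^ 3 * ε₂ ^ 2) ?_
  simp only [Units.val_mul, Units.val_pow_eq_pow_val, map_mul, map_pow, hφu,
    ht.map_fst_unit φ hφ h1, ht.map_snd_unit φ hφ h2]
  linear_combination (π + 3 * π ^ 2 + 9 * π ^ 3 + 20 * π ^ 4) * h5 +
    (211 + 411 * π ^ 1 + 693 * π ^ 2 + 1101 * π ^ 3 + 1637 * π ^ 4 + 2185 * π ^ 5 + 2763 * π ^ 6 +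
        3237 * π ^ 7 + 3417 * π ^ 8 + 3377 * π ^ 9 + 3023 * π ^ 10 + 2350 * π ^ 11 +
        1634 * π ^ 12 + 956 * π ^ 13 + 388 * π ^ 14 + 88 * π ^ 15 + 8 * π ^ 16) * hπ.pow_five

theorem no_thue_solutions_121 (x y : ℤ) :
    x ^ 5 + 65 * x ^ 4 * y - 870 * x ^ 3 * y ^ 2 - 18990 * x ^ 2 * y ^ 3 +
      26325 * x * y ^ 4 + 255069 * y ^ 5 ≠ -(2 ^ 5 * 3 ^ 4 * 11 ^ 2) := by
  intro h
  have h2 : (2 : ℤ) ∣ x - y := by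
    refine (ZMod.intCast_eq_intCast_iff_dvd_sub y x 2).1 (thue_mod_two x y ?_).symm
    have := congrArg (Int.cast (R := ZMod 2)) h
    push_cast at this
    rw [this]
    decide
  have h121 : (121 : ℤ) ∣ x - 29 * y := by
    have := congrArg (Int.cast (R := ZMod 121)) h
    push_cast at this
    rcases thue_mod_one_hundred_twenty_one x y (by rw [this]; decide) with hcase | hcase
    · have hdvd := (ZMod.intCast_eq_intCast_iff_dvd_sub (44 * y) (11 * x) 121).1 (by
        push_cast
        exact hcase.symm)
      obtain ⟨τ, rfl⟩ : ∃ τ, x = 4 * y + 11 * τ := ⟨(x - 4 * y) / 11, by omega⟩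
      have hG : 153 * y ^ 5 - 13585 * τ * y ^ 4 - 22550 * τ ^ 2 * y ^ 3 + 3630 * τ ^ 3 * y ^ 2 +
          10285 * τ ^ 4 * y + 1331 * τ ^ 5 = -2592 := by
        refine mul_left_cancel₀ (by decide : (121 : ℤ) ≠ 0) ?_
        linear_combination h
      exact absurd (by exact_mod_cast congrArg (Int.cast (R := ZMod 11)) hG) (thue_mod_eleven τ y)
    · exact (ZMod.intCast_eq_intCast_iff_dvd_sub (29 * y) x 121).1 (by
        push_cast
        exact hcase.symm)
  have h81 : (3 : ℤ) ∣ x ∨ (81 : ℤ) ∣ x - 40 * y := by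
    have := congrArg (Int.cast (R := ZMod 81)) h
    push_cast at this
    rcases thue_mod_eighty_one x y (by rw [this]; decide) with hcase | hcase
    · have hdvd := (ZMod.intCast_zmod_eq_zero_iff_dvd (27 * x) 81).1 (by
        push_cast
        exact hcase)
      left
      omega
    · exact .inr <| (ZMod.intCast_eq_intCast_iff_dvd_sub (40 * y) x 81).1 (by
        push_cast
        exact hcase.symm)
  rcases h81 with h3 | h81
  · obtain ⟨k, hk⟩ : ∃ k, x = 3 * (171 * y + 242 * k) := ⟨(x / 3 - 171 * y) / 242, by omega⟩
    apply norm_form_ne_one' (3 * k + 2 * y) (7 * k + 5 * y)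
    subst hk
    refine mul_left_cancel₀ (by decide : (-(2 ^ 5 * 3 ^ 4 * 11 ^ 2) : ℤ) ≠ 0) ?_
    linear_combination h
  · obtain ⟨k, hk⟩ : ∃ k, x = 16969 * y + 19602 * k := ⟨(x - 16969 * y) / 19602, by omega⟩
    apply norm_form_ne_one (22 * k + 19 * y) (15 * k + 13 * y)
    subst hk
    refine mul_left_cancel₀ (by decide : (-(2 ^ 5 * 3 ^ 4 * 11 ^ 2) : ℤ) ≠ 0) ?_
    linear_combination h
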